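/- The infinite series identity $\sum_{k=0}^{\infty}\Big(\frac{-1}{4}\Big)^k\frac{((1)_k)^3(1/2)_k}{((5/4)_k)^2((7/4)_k)^2}\Big\{(19+56k+40k^2)\big[H_{k}^{(2)}+H_{1+2k}^{(2)}-4H_{3+4k}^{(2)}\big]+4\Big\} = -72\beta(4)$ holds. -/

import Mathlib

open scoped BigOperators

/-- The shifted factorial (Pochhammer symbol) `(x)_n = x (x+1) ⋯ (x+n-1)`. -/
noncomputable def poch (x : ℝ) (n : ℕ) : ℝ := ∏ i ∈ Finset.range n, (x + i)

/-- The harmonic numbers of order 2, `H_n^{(2)} = ∑_{j=1}^n 1/j²`. -/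
noncomputable def H2 (n : ℕ) : ℝ := ∑ j ∈ Finset.range n, 1 / ((j : ℝ) + 1) ^ 2

/-- The Dirichlet beta value `β(4) = ∑_{k≥0} (-1)^k/(1+2k)⁴`. -/
noncomputable def beta4 : ℝ := ∑' k : ℕ, (-1) ^ k / (1 + 2 * (k : ℝ)) ^ 4

/-- The Catalan constant `G = ∑_{k≥0} (-1)^k/(1+2k)²`. -/
noncomputable def catalanG : ℝ := ∑' k : ℕ, (-1) ^ k / (1 + 2 * (k : ℝ)) ^ 2

open Filter Topology

/-- The squared shifted factorial `((n + 1/2)_m)²`. -/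
noncomputable def halfPochSq (n m : ℕ) : ℝ := ∏ j ∈ Finset.range m, ((n : ℝ) + 1 / 2 + j) ^ 2

/-- The shifted harmonic sum `∑_{j < m} 1 / (n + 1/2 + j)²`. -/
noncomputable def halfHarmonic (n m : ℕ) : ℝ :=
  ∑ j ∈ Finset.range m, 1 / ((n : ℝ) + 1 / 2 + j) ^ 2

/-- The weight `(k!)² (2k)!`. -/
noncomputable def weight (k : ℕ) : ℝ := (k.factorial : ℝ) ^ 2 * ((2 * k).factorial : ℝ)

/-- First component of the Wilf–Zeilberger pair. -/
noncomputable def wzF (n k : ℕ) : ℝ :=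
  (-1) ^ (n + k) * (weight k / halfPochSq n (2 * k + 1)) * (halfHarmonic n (2 * k + 1) - H2 k)

/-- Polynomial part of the certificate of the Wilf–Zeilberger pair. -/
noncomputable def wzPoly (n k : ℕ) : ℝ :=
  (19 + 56 * (k : ℝ) + 40 * (k : ℝ) ^ 2) / 8 + (2 + 3 * (k : ℝ)) * n + (n : ℝ) ^ 2 / 2

/-- Second component of the Wilf–Zeilberger pair. -/
noncomputable def wzG (n k : ℕ) : ℝ :=
  (-1) ^ (n + k) * (weight k / halfPochSq n (2 * k + 2)) *
    (wzPoly n k * (halfHarmonic n (2 * k + 2) - H2 k) - 1 / 2)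

lemma halfPochSq_pos (n m : ℕ) : 0 < halfPochSq n m :=
  Finset.prod_pos fun j _ => by positivity

lemma halfPochSq_succ (n m : ℕ) :
    halfPochSq n (m + 1) = halfPochSq n m * ((n : ℝ) + 1 / 2 + m) ^ 2 := by
  simp [halfPochSq, Finset.prod_range_succ]

lemma halfPochSq_succ' (n m : ℕ) :
    halfPochSq n (m + 1) = halfPochSq (n + 1) m * ((n : ℝ) + 1 / 2) ^ 2 := by
  rw [halfPochSq, Finset.prod_range_succ', halfPochSq]
  congr 1
  · refine Finset.prod_congr rfl fun j _ => ?_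
    push_cast; ring
  · simp

lemma halfHarmonic_succ (n m : ℕ) :
    halfHarmonic n (m + 1) = halfHarmonic n m + 1 / ((n : ℝ) + 1 / 2 + m) ^ 2 := by
  simp [halfHarmonic, Finset.sum_range_succ]

lemma halfHarmonic_succ' (n m : ℕ) :
    halfHarmonic n (m + 1) = halfHarmonic (n + 1) m + 1 / ((n : ℝ) + 1 / 2) ^ 2 := by
  rw [halfHarmonic, Finset.sum_range_succ', halfHarmonic]
  congr 1
  · refine Finset.sum_congr rfl fun j _ => ?_
    push_cast; ring
  · simp

lemma H2_succ (n : ℕ) : H2 (n + 1) = H2 n + 1 / ((n : ℝ) + 1) ^ 2 := by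
  simp [H2, Finset.sum_range_succ]

lemma weight_pos (k : ℕ) : 0 < weight k := by unfold weight; positivity

lemma weight_succ (k : ℕ) :
    weight (k + 1) = weight k * (((k : ℝ) + 1) ^ 2 * (2 * k + 1) * (2 * k + 2)) := by
  unfold weight
  rw [show 2 * (k + 1) = 2 * k + 1 + 1 by ring, Nat.factorial_succ, Nat.factorial_succ,
    Nat.factorial_succ]
  push_cast; ring

/-- The Wilf–Zeilberger relation. -/
lemma wzF_sub_wzF (n k : ℕ) : wzF n k - wzF n (k + 1) = wzG n k - wzG (n + 1) k := by
  have hP := halfPochSq_pos n (2 * k + 1)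
  have hP1 : halfPochSq (n + 1) (2 * k + 2) =
      halfPochSq n (2 * k + 1) * ((n : ℝ) + 1 / 2 + (2 * k + 1)) ^ 2 *
        ((n : ℝ) + 1 / 2 + (2 * k + 2)) ^ 2 / ((n : ℝ) + 1 / 2) ^ 2 := by
    rw [eq_div_iff (by positivity), ← halfPochSq_succ', halfPochSq_succ, halfPochSq_succ]
    push_cast; ring
  have hS1 : halfHarmonic (n + 1) (2 * k + 2) = halfHarmonic n (2 * k + 1)
      + 1 / ((n : ℝ) + 1 / 2 + (2 * k + 1)) ^ 2 + 1 / ((n : ℝ) + 1 / 2 + (2 * k + 2)) ^ 2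
      - 1 / ((n : ℝ) + 1 / 2) ^ 2 := by
    rw [eq_sub_iff_add_eq, ← halfHarmonic_succ', halfHarmonic_succ, halfHarmonic_succ]
    push_cast; ring
  unfold wzF wzG wzPoly
  rw [hP1, hS1, show 2 * (k + 1) + 1 = 2 * k + 1 + 1 + 1 by ring,
    show 2 * k + 2 = 2 * k + 1 + 1 by ring, halfPochSq_succ n (2 * k + 1 + 1),
    halfPochSq_succ n (2 * k + 1), halfHarmonic_succ n (2 * k + 1 + 1),
    halfHarmonic_succ n (2 * k + 1), H2_succ, weight_succ,
    show n + (k + 1) = n + k + 1 by ring, show n + 1 + k = n + k + 1 by ring, pow_succ]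
  push_cast
  generalize halfPochSq n (2 * k + 1) = P at *
  generalize halfHarmonic n (2 * k + 1) = S at *
  generalize H2 k = H
  generalize weight k = w
  generalize (-1 : ℝ) ^ (n + k) = s
  clear hP1 hS1
  have h0 : (n : ℝ) + 1 / 2 ≠ 0 := by positivity
  have h1 : (n : ℝ) + 1 / 2 + (2 * k + 1) ≠ 0 := by positivity
  have h2 : (n : ℝ) + 1 / 2 + (2 * k + 1 + 1) ≠ 0 := by positivity
  have h3 : (k : ℝ) + 1 ≠ 0 := by positivity
  rw [show (n : ℝ) + 1 / 2 + (2 * k + 2) = (n : ℝ) + 1 / 2 + (2 * k + 1 + 1) by ring]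
  field_simp
  ring

lemma halfHarmonic_nonneg (n m : ℕ) : 0 ≤ halfHarmonic n m :=
  Finset.sum_nonneg fun j _ => by positivity

lemma halfHarmonic_le (n m : ℕ) : halfHarmonic n m ≤ 4 * m := by
  induction m with
  | zero => simp [halfHarmonic]
  | succ m ih =>
    rw [halfHarmonic_succ]
    have h : 1 / ((n : ℝ) + 1 / 2 + m) ^ 2 ≤ 4 := by
      rw [div_le_iff₀ (by positivity)]
      nlinarith [Nat.cast_nonneg (α := ℝ) n, Nat.cast_nonneg (α := ℝ) m,
        mul_nonneg (Nat.cast_nonneg (α := ℝ) n) (Nat.cast_nonneg (α := ℝ) m)]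
    push_cast; linarith

lemma H2_nonneg (n : ℕ) : 0 ≤ H2 n := Finset.sum_nonneg fun j _ => by positivity

lemma H2_le (n : ℕ) : H2 n ≤ n := by
  induction n with
  | zero => simp [H2]
  | succ n ih =>
    rw [H2_succ]
    have h : 1 / ((n : ℝ) + 1) ^ 2 ≤ 1 := by
      rw [div_le_iff₀ (by positivity)]
      nlinarith [Nat.cast_nonneg (α := ℝ) n]
    push_cast; linarith

lemma abs_halfHarmonic_sub_H2_le (n m k : ℕ) : |halfHarmonic n m - H2 k| ≤ 4 * m + k := by
  rw [abs_le]
  constructor <;> linarith [halfHarmonic_nonneg n m, halfHarmonic_le n m, H2_nonneg k, H2_le k,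
    Nat.cast_nonneg (α := ℝ) m, Nat.cast_nonneg (α := ℝ) k]

lemma weight_div_halfPochSq_le (n k : ℕ) :
    weight k / halfPochSq n (2 * k + 1) ≤ (1 / 4) ^ k / ((n : ℝ) + 1 / 2) ^ 2 := by
  induction k with
  | zero => simp [weight, halfPochSq]
  | succ k ih =>
    have hP := halfPochSq_pos n (2 * k + 1)
    rw [show 2 * (k + 1) + 1 = 2 * k + 1 + 1 + 1 by ring, halfPochSq_succ, halfPochSq_succ,
      weight_succ, mul_assoc (halfPochSq n (2 * k + 1)), mul_div_mul_comm, pow_succ (1 / 4 : ℝ) k,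
      mul_div_right_comm ((1 / 4 : ℝ) ^ k)]
    have hn := Nat.cast_nonneg (α := ℝ) n
    have hk := Nat.cast_nonneg (α := ℝ) k
    refine mul_le_mul ih ?_ (by positivity) (by positivity)
    rw [div_le_iff₀ (by positivity), ← mul_pow]
    push_cast
    have h : (2 * (k : ℝ) + 3 / 2) * (2 * k + 5 / 2) ≤
        ((n : ℝ) + 1 / 2 + (2 * k + 1)) * (n + 1 / 2 + (2 * k + 1 + 1)) := by
      apply mul_le_mul <;> linarith
    have h2 := pow_le_pow_left₀ (by positivity) h 2
    have h3 : ((k : ℝ) + 1) ^ 2 * (2 * k + 1) * (2 * k + 2) ≤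
        1 / 4 * ((2 * (k : ℝ) + 3 / 2) * (2 * k + 5 / 2)) ^ 2 := by
      have : 0 ≤ (k : ℝ) ^ 3 := by positivity
      have : 0 ≤ (k : ℝ) ^ 2 := by positivity
      nlinarith
    linarith

lemma abs_wzF_le (n k : ℕ) :
    |wzF n k| ≤ (1 / 4) ^ k * (9 * k + 4) / ((n : ℝ) + 1 / 2) ^ 2 := by
  have h0 : 0 ≤ weight k / halfPochSq n (2 * k + 1) :=
    (div_pos (weight_pos k) (halfPochSq_pos _ _)).le
  rw [wzF, abs_mul, abs_mul, abs_pow, abs_neg, abs_one, one_pow, one_mul, abs_of_nonneg h0,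
    mul_div_right_comm]
  refine mul_le_mul (weight_div_halfPochSq_le n k) ?_ (abs_nonneg _) (by positivity)
  refine (abs_halfHarmonic_sub_H2_le _ _ _).trans ?_
  push_cast; linarith

lemma abs_wzG_le (n k : ℕ) :
    |wzG n k| ≤ (1 / 4) ^ k * (18 * k + 17) / ((n : ℝ) + 1 / 2) ^ 2 := by
  have hn := Nat.cast_nonneg (α := ℝ) n
  have hk := Nat.cast_nonneg (α := ℝ) k
  have h0 : 0 ≤ weight k / halfPochSq n (2 * k + 1) :=
    (div_pos (weight_pos k) (halfPochSq_pos _ _)).le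
  have hpoly : 0 ≤ wzPoly n k := by unfold wzPoly; positivity
  have hpoly' : wzPoly n k ≤ 2 * ((n : ℝ) + 1 / 2 + (2 * k + 1)) ^ 2 := by
    unfold wzPoly
    nlinarith [mul_nonneg hn hk]
  have hsplit : wzG n k = (-1) ^ (n + k) * (weight k / halfPochSq n (2 * k + 1)) *
      ((wzPoly n k * (halfHarmonic n (2 * k + 2) - H2 k) - 1 / 2) /
        ((n : ℝ) + 1 / 2 + (2 * k + 1)) ^ 2) := by
    have hP := (halfPochSq_pos n (2 * k + 1)).ne'
    rw [wzG, halfPochSq_succ n (2 * k + 1)]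
    push_cast
    field_simp
  rw [hsplit, abs_mul, abs_mul, abs_pow, abs_neg, abs_one, one_pow, one_mul, abs_of_nonneg h0,
    mul_div_right_comm]
  refine mul_le_mul (weight_div_halfPochSq_le n k) ?_ (abs_nonneg _) (by positivity)
  rw [abs_div, abs_of_pos (show (0 : ℝ) < ((n : ℝ) + 1 / 2 + (2 * k + 1)) ^ 2 by positivity),
    div_le_iff₀ (by positivity)]
  have hb := abs_halfHarmonic_sub_H2_le n (2 * k + 2) k
  push_cast at hb
  have hm : |wzPoly n k * (halfHarmonic n (2 * k + 2) - H2 k)| ≤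
      2 * ((n : ℝ) + 1 / 2 + (2 * k + 1)) ^ 2 * (9 * k + 8) := by
    rw [abs_mul, abs_of_nonneg hpoly]
    exact mul_le_mul hpoly' (by linarith) (abs_nonneg _) (by positivity)
  have hs := abs_sub (wzPoly n k * (halfHarmonic n (2 * k + 2) - H2 k)) (1 / 2)
  rw [abs_of_pos (show (0 : ℝ) < 1 / 2 by norm_num)] at hs
  have h1 : 1 ≤ ((n : ℝ) + 1 / 2 + (2 * k + 1)) ^ 2 := by nlinarith
  linarith

lemma summable_geometric_mul_linear (a b : ℝ) :
    Summable fun k : ℕ => (1 / 4 : ℝ) ^ k * (a * k + b) := by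
  have h1 : Summable fun k : ℕ => ((k : ℝ) ^ 1 * (1 / 4 : ℝ) ^ k) :=
    summable_pow_mul_geometric_of_norm_lt_one 1 (by norm_num)
  have h2 : Summable fun k : ℕ => (1 / 4 : ℝ) ^ k :=
    summable_geometric_of_lt_one (by norm_num) (by norm_num)
  refine ((h1.mul_left a).add (h2.mul_left b)).congr fun k => ?_
  ring

lemma summable_wzG (n : ℕ) : Summable (wzG n) :=
  Summable.of_norm_bounded ((summable_geometric_mul_linear 18 17).div_const _) (abs_wzG_le n)

lemma tendsto_wzF (n : ℕ) : Tendsto (wzF n) atTop (𝓝 0) :=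
  squeeze_zero_norm (abs_wzF_le n)
    ((summable_geometric_mul_linear 9 4).div_const _).tendsto_atTop_zero

lemma tsum_wzG_sub (n : ℕ) : ∑' k, wzG n k - ∑' k, wzG (n + 1) k = wzF n 0 := by
  have h := ((summable_wzG n).hasSum.sub (summable_wzG (n + 1)).hasSum).tendsto_sum_nat
  have h' : Tendsto (fun K => wzF n 0 - wzF n K) atTop (𝓝 (wzF n 0 - 0)) :=
    tendsto_const_nhds.sub (tendsto_wzF n)
  rw [sub_zero] at h'
  refine tendsto_nhds_unique h (h'.congr fun K => ?_)
  rw [← Finset.sum_range_sub']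
  exact Finset.sum_congr rfl fun k _ => wzF_sub_wzF n k

lemma tendsto_one_div_add_half_sq :
    Tendsto (fun n : ℕ => 1 / ((n : ℝ) + 1 / 2) ^ 2) atTop (𝓝 0) := by
  have h : Tendsto (fun n : ℕ => ((n : ℝ) + 1 / 2) ^ 2) atTop atTop :=
    (tendsto_pow_atTop two_ne_zero).comp
      (tendsto_atTop_add_const_right _ _ tendsto_natCast_atTop_atTop)
  simp only [one_div] at h ⊢
  exact h.inv_tendsto_atTop

lemma tendsto_tsum_wzG : Tendsto (fun n => ∑' k, wzG n k) atTop (𝓝 0) := by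
  have hb : ∀ n, ‖∑' k, wzG n k‖ ≤
      (∑' k : ℕ, (1 / 4 : ℝ) ^ k * (18 * k + 17)) * (1 / ((n : ℝ) + 1 / 2) ^ 2) := fun n => by
    rw [mul_one_div, ← tsum_div_const]
    exact tsum_of_norm_bounded ((summable_geometric_mul_linear 18 17).div_const _).hasSum
      (abs_wzG_le n)
  refine squeeze_zero_norm hb ?_
  simpa using tendsto_one_div_add_half_sq.const_mul
    (∑' k : ℕ, (1 / 4 : ℝ) ^ k * (18 * k + 17))

lemma wzF_zero_right (n : ℕ) : wzF n 0 = 16 * ((-1) ^ n / (1 + 2 * (n : ℝ)) ^ 4) := by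
  have h : (n : ℝ) + 1 / 2 ≠ 0 := by positivity
  rw [show 1 + 2 * (n : ℝ) = 2 * (n + 1 / 2) by ring]
  simp only [wzF, weight, halfPochSq, halfHarmonic, H2]
  simp
  field_simp
  ring

lemma summable_beta4 : Summable fun k : ℕ => (-1 : ℝ) ^ k / (1 + 2 * (k : ℝ)) ^ 4 := by
  have h : Summable fun k : ℕ => 1 / ((k + 1 : ℕ) : ℝ) ^ 4 :=
    (summable_nat_add_iff 1).2 (Real.summable_one_div_nat_pow.2 (by norm_num))
  refine Summable.of_norm_bounded h fun k => ?_
  rw [norm_div, norm_pow, norm_neg, norm_one, one_pow, Real.norm_of_nonneg (by positivity)]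
  push_cast
  gcongr 1 / ?_ ^ 4
  linarith [Nat.cast_nonneg (α := ℝ) k]

lemma tsum_wzG_zero : ∑' k, wzG 0 k = 16 * beta4 := by
  have h1 : Tendsto (fun N => ∑ n ∈ Finset.range N, wzF n 0) atTop (𝓝 (16 * beta4)) := by
    simp only [wzF_zero_right]
    exact (summable_beta4.hasSum.mul_left 16).tendsto_sum_nat
  have h2 : Tendsto (fun N => ∑' k, wzG 0 k - ∑' k, wzG N k) atTop (𝓝 (∑' k, wzG 0 k - 0)) :=
    tendsto_const_nhds.sub tendsto_tsum_wzG
  rw [sub_zero] at h2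
  refine tendsto_nhds_unique h2 (h1.congr fun N => ?_)
  rw [← Finset.sum_range_sub' fun n => ∑' k, wzG n k]
  exact Finset.sum_congr rfl fun n _ => (tsum_wzG_sub n).symm

lemma poch_succ (x : ℝ) (n : ℕ) : poch x (n + 1) = poch x n * (x + n) := by
  simp [poch, Finset.prod_range_succ]

lemma poch_pos {x : ℝ} (hx : 0 < x) (n : ℕ) : 0 < poch x n :=
  Finset.prod_pos fun j _ => by positivity

lemma weight_eq_poch (k : ℕ) : weight k = 4 ^ k * (poch 1 k ^ 3 * poch (1 / 2) k) := by
  induction k with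
  | zero => simp [weight, poch]
  | succ k ih => rw [weight_succ, ih, poch_succ, poch_succ]; ring

lemma halfPochSq_eq_poch (k : ℕ) :
    halfPochSq 0 (2 * k + 2) = 9 / 16 * 16 ^ k * (poch (5 / 4) k ^ 2 * poch (7 / 4) k ^ 2) := by
  induction k with
  | zero => norm_num [halfPochSq, poch, Finset.prod_range_succ]
  | succ k ih =>
    rw [show 2 * (k + 1) + 2 = 2 * k + 2 + 1 + 1 by ring, halfPochSq_succ, halfPochSq_succ, ih,
      poch_succ, poch_succ]
    push_cast; ring

lemma four_mul_H2 (k : ℕ) : 4 * H2 (3 + 4 * k) = halfHarmonic 0 (2 * k + 2) + H2 (1 + 2 * k) := by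
  induction k with
  | zero => norm_num [halfHarmonic, H2, Finset.sum_range_succ]
  | succ k ih =>
    rw [show 2 * (k + 1) + 2 = 2 * k + 2 + 1 + 1 by ring,
      show 3 + 4 * (k + 1) = 3 + 4 * k + 1 + 1 + 1 + 1 by ring,
      show 1 + 2 * (k + 1) = 1 + 2 * k + 1 + 1 by ring]
    simp only [halfHarmonic_succ, H2_succ, mul_add, ih]
    push_cast
    have h (x : ℝ) : 4 * (1 / (2 * x) ^ 2) = 1 / x ^ 2 := by ring
    rw [← h (0 + 1 / 2 + (2 * k + 2)), ← h (0 + 1 / 2 + (2 * k + 3)), ← h (1 + 2 * k + 1),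
      ← h (1 + 2 * k + 1 + 1)]
    ring

lemma summand_eq_wzG (k : ℕ) :
    (-1/4 : ℝ) ^ k *
      (poch 1 k ^ 3 * poch (1/2) k / (poch (5/4) k ^ 2 * poch (7/4) k ^ 2)) *
      ((19 + 56 * (k : ℝ) + 40 * (k : ℝ) ^ 2) *
        (H2 k + H2 (1 + 2 * k) - 4 * H2 (3 + 4 * k)) + 4) = -(9 / 2) * wzG 0 k := by
  have h5 := poch_pos (show (0 : ℝ) < 5 / 4 by norm_num) k
  have h7 := poch_pos (show (0 : ℝ) < 7 / 4 by norm_num) k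
  rw [four_mul_H2, wzG, wzPoly, weight_eq_poch, halfPochSq_eq_poch, div_pow,
    show (16 : ℝ) ^ k = 4 ^ k * 4 ^ k by rw [← mul_pow]; norm_num]
  push_cast
  rw [zero_add]
  field_simp
  ring

theorem stmt3 :
    (∑' k : ℕ, (-1/4 : ℝ) ^ k *
      (poch 1 k ^ 3 * poch (1/2) k / (poch (5/4) k ^ 2 * poch (7/4) k ^ 2)) *
      ((19 + 56 * (k : ℝ) + 40 * (k : ℝ) ^ 2) *
        (H2 k + H2 (1 + 2 * k) - 4 * H2 (3 + 4 * k)) + 4)) = -72 * beta4 := by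
  simp only [summand_eq_wzG]
  rw [tsum_mul_left, tsum_wzG_zero]
  ring
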